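/- Suppose weights are degree-monotone in a generating tuple ⟨μ,d⟩ and a directed tree T ∈ ℛ(μ,d) contains disjoint directed paths (v, m₁, …, m_k, m) and (v′, m₁′, …, m_l′, m) from internal vertices v, v′ ∈ M to some vertex m ∈ M, with 0 ≤ k ≤ l, d_T(v′) − d_T(v) > 0, f_T(v) ≥ f_T(v′), and f_T(m_i) ≥ f_T(m_i′) for i = 1, …, k. Then there exists a directed tree T′ ∈ ℛ(μ,d) such that f(T′) strictly weakly majorizes f(T), i.e., f(T′) ≻^w f(T). -/

import Mathlib

open scoped Classical
noncomputable section

/-- A directed tree on a finite vertex set `V`: each vertex has an outbound arc to its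
`parent`, the `root` is a fixed point of `parent` (i.e. has no genuine outbound arc), and
every vertex reaches the root by iterating `parent`. -/
structure DirTree (V : Type) [Fintype V] [DecidableEq V] where
  root : V
  parent : V → V
  parent_root : parent root = root
  reaches : ∀ v, ∃ n, parent^[n] v = root

variable {V : Type} [Fintype V] [DecidableEq V]

namespace DirTree

/-- `u` belongs to the subordinate group of `v`: there is a directed path from `u` to `v`. -/
def Desc (T : DirTree V) (u v : V) : Prop := ∃ n, T.parent^[n] u = v

/-- The set of vertices with an arc to `v`. -/
def children (T : DirTree V) (v : V) : Finset V :=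
  Finset.univ.filter fun u => T.parent u = v ∧ u ≠ v

/-- Weight `f_T(v)` of the subordinate group of `v`. -/
def f (T : DirTree V) (μ : V → ℝ) (v : V) : ℝ :=
  ∑ u ∈ Finset.univ.filter (fun u => T.Desc u v), μ u

/-- Degree of `v` in the underlying undirected tree. -/
def deg (T : DirTree V) (v : V) : ℕ :=
  (T.children v).card + (if v = T.root then 0 else 1)

/-- The underlying undirected tree. -/
def toGraph (T : DirTree V) : SimpleGraph V :=
  SimpleGraph.fromRel fun u v => T.parent u = v ∧ u ≠ v

/-- The vector (as a multiset, i.e. up to ascending rearrangement) of subordinate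
groups' weights of internal non-root vertices. -/
def fvec (T : DirTree V) (μ : V → ℝ) : Multiset ℝ :=
  (Finset.univ.filter fun m => 1 < T.deg m ∧ m ≠ T.root).val.map (T.f μ)

end DirTree

/-- Degree of a vertex in a simple graph. -/
def gdeg (G : SimpleGraph V) (v : V) : ℕ :=
  (Finset.univ.filter fun u => G.Adj v u).card

/-- `⟨μ, d⟩` is a generating tuple: nonnegative weights, degrees at least 1 summing to
`2(|V|-1)`, at least two pendent and at least one internal vertex. -/
structure IsGenTuple (μ : V → ℝ) (d : V → ℕ) : Prop where
  nonneg : ∀ v, 0 ≤ μ v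
  deg_pos : ∀ v, 1 ≤ d v
  sum_deg : ∑ v, d v = 2 * (Fintype.card V - 1)
  two_le_pendent : 2 ≤ (Finset.univ.filter fun v => d v = 1).card
  one_le_internal : 1 ≤ (Finset.univ.filter fun v => 1 < d v).card

/-- Weights are degree-monotone in `⟨μ, d⟩`. -/
def DegMonotone (μ : V → ℝ) (d : V → ℕ) : Prop :=
  (∀ m m', 1 < d m → 1 < d m' → d m < d m' → μ m ≤ μ m') ∧
  ∀ v, d v = 1 → 0 < μ v

/-- `T ∈ ℛ(μ,d)`: directed tree with internal root whose (undirected) degrees match `d`. -/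
def memR (T : DirTree V) (d : V → ℕ) : Prop :=
  1 < d T.root ∧ ∀ v, T.deg v = d v

/-- `G ∈ 𝒯(μ,d)`: `G` is a tree whose degrees match `d`. -/
def memT (G : SimpleGraph V) (d : V → ℕ) : Prop :=
  G.IsTree ∧ ∀ v, gdeg G v = d v

/-- Vertex-weighted Wiener index. -/
def VWWI (μ : V → ℝ) (G : SimpleGraph V) : ℝ :=
  (1 / 2) * ∑ u, ∑ v, μ u * μ v * (G.dist u v : ℝ)

/-- `S = (m, L)` is a minimal star for the state `(U, μ, d)`: the center `m` is an
internal vertex of `U` of least degree among internal vertices of least weight, and the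
`d m - 1` leaves `L` are pendent vertices of `U` of least weights. -/
def IsMinimalStar (U : Finset V) (μ : V → ℝ) (d : V → ℕ) (m : V) (L : Finset V) : Prop :=
  m ∈ U ∧ 1 < d m ∧ L ⊆ U ∧ m ∉ L ∧ L.card = d m - 1 ∧
  (∀ v ∈ L, d v = 1) ∧
  (∀ m' ∈ U, 1 < d m' → μ m ≤ μ m') ∧
  (∀ m' ∈ U, 1 < d m' → μ m' = μ m → d m ≤ d m') ∧
  ∀ u ∈ L, ∀ w ∈ U, d w = 1 → w ∉ L → μ u ≤ μ w

/-- Centers used before step `i` (0-indexed). -/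
def usedCenters {q : ℕ} (c : Fin q → V) (i : ℕ) : Finset V :=
  (Finset.univ.filter fun j : Fin q => (j : ℕ) < i).image c

/-- Vertex set `V_{i+1}` of the state of the Huffman algorithm before (0-indexed) step `i`,
for the candidate Huffman tree `T` with star centers `c`. -/
def stateV (T : DirTree V) {q : ℕ} (c : Fin q → V) (i : ℕ) : Finset V :=
  Finset.univ \ (Finset.univ.filter fun j : Fin q => (j : ℕ) < i).biUnion fun j => T.children (c j)

/-- Weight function `μ^{i+1}` of the state before (0-indexed) step `i`. -/
def stateMu (T : DirTree V) (μ : V → ℝ) {q : ℕ} (c : Fin q → V) (i : ℕ) : V → ℝ :=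
  fun v => if v ∈ usedCenters c i then T.f μ v else μ v

/-- Degree function `d^{i+1}` of the state before (0-indexed) step `i`. -/
def stateD (d : V → ℕ) {q : ℕ} (c : Fin q → V) (i : ℕ) : V → ℕ :=
  fun v => if v ∈ usedCenters c i then 1 else d v

/-- `T` is a directed Huffman tree for `⟨μ, d⟩` whose star sequence has centers
`c 0, …, c (q-1)` (so `S_i` has leaf set `children (c i)`): the centers enumerate the
internal vertices, the root is the last center, and at each of the first `q - 1` steps
the corresponding star is a minimal star of the current state. -/
def IsHuffmanSeq (μ : V → ℝ) (d : V → ℕ) (T : DirTree V) {q : ℕ} (c : Fin q → V) : Prop :=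
  (∀ v, T.deg v = d v) ∧
  Function.Injective c ∧
  (∀ v, 1 < d v ↔ ∃ j, c j = v) ∧
  (∀ hq : 0 < q, T.root = c ⟨q - 1, Nat.sub_lt hq Nat.one_pos⟩) ∧
  ∀ i : Fin q, (i : ℕ) < q - 1 →
    IsMinimalStar (stateV T c (i : ℕ)) (stateMu T μ c (i : ℕ)) (stateD d c (i : ℕ))
      (c i) (T.children (c i))

/-- `T ∈ ℛℋ(μ,d)`: `T` is a directed Huffman tree for `⟨μ, d⟩`. -/
def IsHuffmanDir (μ : V → ℝ) (d : V → ℕ) (T : DirTree V) : Prop :=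
  ∃ (q : ℕ) (c : Fin q → V), IsHuffmanSeq μ d T c

/-- Sum of the `k` smallest components of a multiset of reals. -/
def ascSum (s : Multiset ℝ) (k : ℕ) : ℝ := ((s.sort (· ≤ ·)).take k).sum

/-- `x` weakly majorizes `y` (`y ⪯^w x`). -/
def WMaj (x y : Multiset ℝ) : Prop :=
  Multiset.card x = Multiset.card y ∧ ∀ k, ascSum x k ≤ ascSum y k

/-- `x` strictly weakly majorizes `y` (`y ≺^w x`). -/
def SWMaj (x y : Multiset ℝ) : Prop := WMaj x y ∧ x ≠ y

namespace DirTree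

theorem iterate_parent_root (T : DirTree V) (n : ℕ) : T.parent^[n] T.root = T.root :=
  Function.iterate_fixed T.parent_root n

theorem eq_root_of_iterate_eq (T : DirTree V) {a : V} {n : ℕ}
    (h : T.parent^[n + 1] a = a) : a = T.root := by
  obtain ⟨N, hN⟩ := T.reaches a
  have h1 : T.parent^[(n + 1) * N] a = a := by
    rw [Function.iterate_mul]; exact Function.iterate_fixed h N
  have h2 : (n + 1) * N = n * N + N := by ring
  rw [h2, Function.iterate_add_apply, hN, iterate_parent_root] at h1
  exact h1.symm

theorem Desc.refl (T : DirTree V) (u : V) : T.Desc u u := ⟨0, rfl⟩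

theorem Desc.trans {T : DirTree V} {a b c : V} (h : T.Desc a b) (h' : T.Desc b c) :
    T.Desc a c := by
  obtain ⟨n, rfl⟩ := h
  obtain ⟨k, rfl⟩ := h'
  exact ⟨k + n, Function.iterate_add_apply _ _ _ _⟩

theorem desc_parent (T : DirTree V) (u : V) : T.Desc u (T.parent u) := ⟨1, rfl⟩

theorem desc_root_iff {T : DirTree V} {u : V} : T.Desc T.root u ↔ u = T.root := by
  constructor
  · rintro ⟨n, rfl⟩
    exact T.iterate_parent_root n
  · rintro rfl
    exact Desc.refl _ _

theorem desc_iff {T : DirTree V} {a b : V} : T.Desc a b ↔ a = b ∨ T.Desc (T.parent a) b := by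
  constructor
  · rintro ⟨n, hn⟩
    cases n with
    | zero => exact Or.inl hn
    | succ n => exact Or.inr ⟨n, hn⟩
  · rintro (rfl | h)
    · exact Desc.refl _ _
    · exact (T.desc_parent a).trans h

theorem not_desc_parent {T : DirTree V} {a : V} (ha : a ≠ T.root) :
    ¬ T.Desc (T.parent a) a := by
  rintro ⟨n, hn⟩
  exact ha (T.eq_root_of_iterate_eq (n := n) hn)

theorem Desc.antisymm {T : DirTree V} {a b : V} (h : T.Desc a b) (h' : T.Desc b a) : a = b := by
  rcases desc_iff.1 h with h | h
  · exact h
  · by_cases ha : a = T.root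
    · subst ha
      rw [T.parent_root, desc_root_iff] at h
      exact h.symm
    · exact absurd (h.trans h') (not_desc_parent ha)

theorem Desc.total {T : DirTree V} {w a b : V} (h : T.Desc w a) (h' : T.Desc w b) :
    T.Desc a b ∨ T.Desc b a := by
  obtain ⟨n, rfl⟩ := h
  obtain ⟨k, rfl⟩ := h'
  rcases le_total n k with hk | hk
  · obtain ⟨j, rfl⟩ := Nat.exists_eq_add_of_le' hk
    exact Or.inl ⟨j, (Function.iterate_add_apply _ _ _ _).symm⟩
  · obtain ⟨j, rfl⟩ := Nat.exists_eq_add_of_le' hk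
    exact Or.inr ⟨j, (Function.iterate_add_apply _ _ _ _).symm⟩

theorem mem_children {T : DirTree V} {u v : V} : u ∈ T.children v ↔ T.parent u = v ∧ u ≠ v := by
  simp [children]

theorem ne_root_of_mem_children {T : DirTree V} {u v : V} (h : u ∈ T.children v) :
    u ≠ T.root := by
  rintro rfl
  rw [mem_children, T.parent_root] at h
  exact h.2 h.1

theorem mem_children_iff {T : DirTree V} {u v : V} :
    u ∈ T.children v ↔ u ≠ T.root ∧ T.parent u = v := by
  refine ⟨fun h => ⟨ne_root_of_mem_children h, (mem_children.1 h).1⟩, ?_⟩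
  rintro ⟨h, rfl⟩
  exact mem_children.2 ⟨rfl, fun h' => h (T.eq_root_of_iterate_eq (n := 0) h'.symm)⟩

theorem f_eq_sum_ite (T : DirTree V) (μ : V → ℝ) (u : V) :
    T.f μ u = ∑ w, if T.Desc w u then μ w else 0 := by
  rw [f, Finset.sum_filter]

theorem sum_children (T : DirTree V) (g : V → ℝ) (u : V) :
    ∑ c ∈ T.children u, g c = ∑ c, if c ≠ T.root ∧ T.parent c = u then g c else 0 := by
  rw [← Finset.sum_filter]
  refine Finset.sum_congr ?_ fun _ _ => rfl
  ext c
  simp [mem_children_iff]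

/-- A function obeying the recursion of subordinate weights is the subordinate weight. -/
theorem f_eq_of_recursion (T : DirTree V) {μ g : V → ℝ}
    (h : ∀ u, g u = μ u + ∑ c ∈ T.children u, g c) (u : V) : T.f μ u = g u := by
  have hμ : ∀ w, μ w = g w - ∑ c, if c ≠ T.root ∧ T.parent c = w then g c else 0 := by
    intro w
    rw [← sum_children]
    linarith [h w]
  have h1 : T.f μ u = ∑ w, (if T.Desc w u then g w else 0)
      - ∑ w, ∑ c, if T.Desc w u then (if c ≠ T.root ∧ T.parent c = w then g c else 0) else 0 := by
    rw [f_eq_sum_ite, ← Finset.sum_sub_distrib]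
    refine Finset.sum_congr rfl fun w _ => ?_
    split_ifs
    · exact hμ w
    · simp
  rw [h1, Finset.sum_comm, ← Finset.sum_sub_distrib]
  rw [Finset.sum_eq_single u]
  · rw [if_pos (Desc.refl T u), Finset.sum_eq_zero, sub_zero]
    intro w _
    split_ifs with hw hc
    · exact absurd (hc.2 ▸ hw) (not_desc_parent hc.1)
    · rfl
    · rfl
  · intro c _ hc
    rw [Finset.sum_eq_single (T.parent c)]
    · by_cases hr : c = T.root
      · have : ¬ T.Desc c u := by
          intro hd
          rw [hr, desc_root_iff] at hd
          exact hc (hr.trans hd.symm)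
        simp only [hr, ne_eq, not_true_eq_false, false_and, if_false, ite_self, sub_zero,
          ite_eq_right_iff]
        intro hd
        exact absurd (hr ▸ hd) this
      · have : T.Desc c u ↔ T.Desc (T.parent c) u := by
          rw [desc_iff]; simp [hc]
        simp [hr, this]
    · intro w _ hw
      rw [if_neg (fun h : c ≠ T.root ∧ T.parent c = w => hw h.2.symm)]
      simp
    · simp
  · simp

theorem f_recursion (T : DirTree V) (μ : V → ℝ) (u : V) :
    T.f μ u = μ u + ∑ c ∈ T.children u, T.f μ c := by
  have hcase : ∀ w, T.Desc w u ↔ w = u ∨ ∃ c ∈ T.children u, T.Desc w c := by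
    intro w
    constructor
    · rintro ⟨n, hn⟩
      induction n generalizing w with
      | zero => exact Or.inl hn
      | succ n ih =>
        rcases ih _ hn with h | ⟨c, hc, h⟩
        · by_cases hw : w = T.root
          · left
            rw [hw, T.parent_root] at h
            rw [hw, h]
          · exact Or.inr ⟨w, mem_children_iff.2 ⟨hw, h⟩, Desc.refl _ _⟩
        · exact Or.inr ⟨c, hc, (T.desc_parent w).trans h⟩
    · rintro (rfl | ⟨c, hc, h⟩)
      · exact Desc.refl _ _
      · exact h.trans ((mem_children_iff.1 hc).2 ▸ T.desc_parent c)
  have hself : ∀ c ∈ T.children u, ¬ T.Desc u c := by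
    intro c hc h
    rw [mem_children_iff] at hc
    exact not_desc_parent hc.1 (hc.2 ▸ h)
  have huniq : ∀ w, ∀ c ∈ T.children u, ∀ c' ∈ T.children u,
      T.Desc w c → T.Desc w c' → c = c' := by
    have key : ∀ c ∈ T.children u, ∀ c' ∈ T.children u, T.Desc c c' → c = c' := by
      intro c hc c' hc' h
      rcases desc_iff.1 h with h | h
      · exact h
      · rw [(mem_children_iff.1 hc).2] at h
        exact absurd h (hself c' hc')
    intro w c hc c' hc' h h'
    rcases h.total h' with h | h
    · exact key c hc c' hc' h
    · exact (key c' hc' c hc h).symm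
  simp only [f_eq_sum_ite]
  rw [Finset.sum_comm]
  have h0 : μ u = ∑ w, if w = u then μ w else 0 := by simp
  rw [h0, ← Finset.sum_add_distrib]
  refine Finset.sum_congr rfl fun w _ => ?_
  by_cases hw : w = u
  · subst hw
    rw [if_pos (Desc.refl _ _), if_pos rfl, Finset.sum_eq_zero, add_zero]
    intro c hc
    rw [if_neg (hself c hc)]
  · rw [if_neg hw, zero_add]
    by_cases hd : T.Desc w u
    · rw [if_pos hd]
      obtain ⟨c, hc, h⟩ := ((hcase w).1 hd).resolve_left hw
      rw [Finset.sum_eq_single_of_mem c hc, if_pos h]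
      intro c' hc' hne
      exact if_neg fun h' => hne (huniq w c' hc' c hc h' h)
    · rw [if_neg hd, Finset.sum_eq_zero]
      intro c hc
      exact if_neg fun h => hd ((hcase w).2 (Or.inr ⟨c, hc, h⟩))

/-- If childless vertices have positive weight, every non-root vertex has positive
subordinate weight. -/
theorem f_pos (T : DirTree V) {μ : V → ℝ} (h0 : ∀ v, 0 ≤ μ v)
    (hleaf : ∀ v, T.children v = ∅ → 0 < μ v) {c : V} (hc : c ≠ T.root) : 0 < T.f μ c := by
  by_contra! hle
  have hz : ∀ w, T.Desc w c → ∃ b, b ∈ T.children w := by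
    intro w hw
    by_contra! hb
    have h1 := hleaf w (Finset.eq_empty_of_forall_notMem hb)
    have h2 : μ w ≤ T.f μ c :=
      Finset.single_le_sum (f := μ) (fun i _ => h0 i) (by simpa using hw)
    linarith
  choose! ch hch using hz
  let F : {w // T.Desc w c} → {w // T.Desc w c} := fun w =>
    ⟨ch w, Desc.trans ⟨1, (mem_children_iff.1 (hch w w.2)).2⟩ w.2⟩
  have hF : Function.Injective F := by
    intro a b hab
    have : ch a = ch b := congrArg Subtype.val hab
    apply Subtype.ext
    rw [← (mem_children_iff.1 (hch a a.2)).2, ← (mem_children_iff.1 (hch b b.2)).2, this]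
  obtain ⟨w, hw⟩ := Finite.injective_iff_surjective.1 hF ⟨c, Desc.refl _ _⟩
  have hw' : ch w = c := congrArg Subtype.val hw
  have h1 := (mem_children_iff.1 (hch w w.2)).2
  rw [hw'] at h1
  exact not_desc_parent hc (h1 ▸ w.2)

/-- Reattach all vertices of `D` to `v`. -/
def reattach (T : DirTree V) (D : Finset V) (v : V) (hroot : T.root ∉ D)
    (hv : ∀ c ∈ D, ¬ T.Desc v c) : DirTree V where
  root := T.root
  parent u := if u ∈ D then v else T.parent u
  parent_root := by rw [if_neg hroot, T.parent_root]
  reaches := by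
    set p : V → V := fun u => if u ∈ D then v else T.parent u with hp
    have step : ∀ w, (∃ n, p^[n] (p w) = T.root) → ∃ n, p^[n] w = T.root :=
      fun w ⟨n, hn⟩ => ⟨n + 1, hn⟩
    have outside : ∀ n w, T.parent^[n] w = T.root → (∀ c ∈ D, ¬ T.Desc w c) →
        ∃ n, p^[n] w = T.root := by
      intro n
      induction n with
      | zero => exact fun w hw _ => ⟨0, hw⟩
      | succ n ih =>
        intro w hw hD
        apply step
        have : p w = T.parent w := if_neg fun h => hD w h (Desc.refl _ _)
        rw [this]
        exact ih _ hw fun c hc h => hD c hc ((T.desc_parent w).trans h)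
    obtain ⟨nv, hnv⟩ := T.reaches v
    have reach_v := outside nv v hnv hv
    intro w
    obtain ⟨n, hn⟩ := T.reaches w
    induction n generalizing w with
    | zero => exact ⟨0, hn⟩
    | succ n ih =>
      apply step
      by_cases hw : w ∈ D
      · have : p w = v := if_pos hw
        rwa [this]
      · have : p w = T.parent w := if_neg hw
        rw [this]
        exact ih _ hn

/-- Rename the vertices of a directed tree along a permutation. -/
def rename (T : DirTree V) (σ : Equiv.Perm V) : DirTree V where
  root := σ T.root
  parent u := σ (T.parent (σ.symm u))
  parent_root := by simp [T.parent_root]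
  reaches := by
    intro w
    obtain ⟨n, hn⟩ := T.reaches (σ.symm w)
    refine ⟨n, ?_⟩
    have h : Function.Semiconj σ T.parent (fun u => σ (T.parent (σ.symm u))) := fun u => by simp
    have := (h.iterate_right n).eq (σ.symm w)
    rw [σ.apply_symm_apply] at this
    rw [← this, hn]

theorem children_rename (T : DirTree V) (σ : Equiv.Perm V) (u : V) :
    (T.rename σ).children (σ u) = (T.children u).map σ.toEmbedding := by
  ext w
  simp only [mem_children_iff, Finset.mem_map_equiv, rename, ne_eq, EmbeddingLike.apply_eq_iff_eq,
    Equiv.symm_apply_eq]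

theorem deg_rename (T : DirTree V) (σ : Equiv.Perm V) (u : V) :
    (T.rename σ).deg (σ u) = T.deg u := by
  have : (σ u = (T.rename σ).root) = (u = T.root) := by simp [rename]
  simp only [deg, children_rename, Finset.card_map, this]

theorem f_rename (T : DirTree V) (σ : Equiv.Perm V) (μ : V → ℝ) (u : V) :
    (T.rename σ).f μ (σ u) = T.f (μ ∘ σ) u := by
  have h := (T.rename σ).f_eq_of_recursion (μ := μ) (g := fun w => T.f (μ ∘ σ) (σ.symm w)) ?_ (σ u)
  · simpa using h
  · intro w
    obtain ⟨w, rfl⟩ := σ.surjective w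
    rw [children_rename, Finset.sum_map]
    simp only [Equiv.symm_apply_apply, Equiv.coe_toEmbedding]
    exact f_recursion T _ _

theorem map_parent_of_isChain (T : DirTree V) {v m : V} {ms : List V}
    (h : ((v :: ms) ++ [m]).IsChain fun a b => T.parent a = b) :
    (v :: ms).map T.parent = ms ++ [m] := by
  induction ms generalizing v with
  | nil => simpa using h
  | cons a ms ih =>
    simp only [List.cons_append, List.isChain_cons_cons] at h
    rw [List.map_cons, ih (by simpa using h.2), h.1]
    rfl

theorem desc_cases_of_map_parent {T : DirTree V} {v m u w : V} {ms : List V}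
    (h : (v :: ms).map T.parent = ms ++ [m]) (hu : u ∈ v :: ms) (hd : T.Desc u w) :
    w ∈ v :: ms ∨ T.Desc m w := by
  obtain ⟨n, hn⟩ := hd
  induction n generalizing u with
  | zero => exact Or.inl (hn ▸ hu)
  | succ n ih =>
    have hp : T.parent u ∈ ms ++ [m] := h ▸ List.mem_map_of_mem hu
    rcases List.mem_append.1 hp with hp | hp
    · exact ih (List.mem_cons_of_mem _ hp) hn
    · rw [List.mem_singleton] at hp
      exact Or.inr ⟨n, by rw [← hp]; exact hn⟩

theorem desc_end_of_map_parent {T : DirTree V} {v m : V} {ms : List V}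
    (h : (v :: ms).map T.parent = ms ++ [m]) : ∀ u ∈ v :: ms, T.Desc u m := by
  induction ms generalizing v with
  | nil =>
    intro u hu
    simp only [List.mem_singleton] at hu
    subst hu
    simp only [List.map_cons, List.map_nil, List.nil_append, List.cons.injEq, and_true] at h
    exact h ▸ T.desc_parent u
  | cons a ms ih =>
    simp only [List.map_cons, List.cons_append, List.cons.injEq] at h
    have h' := ih (by simpa using h.2)
    intro u hu
    rcases List.mem_cons.1 hu with rfl | hu
    · exact (h.1 ▸ T.desc_parent u : T.Desc u a).trans (h' a List.mem_cons_self)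
    · exact h' u hu

theorem ne_root_of_mem_path {T : DirTree V} {v m : V} {ms : List V}
    (h : (v :: ms).map T.parent = ms ++ [m]) (hn : ((v :: ms) ++ [m]).Nodup) :
    ∀ u ∈ v :: ms, u ≠ T.root := by
  rintro u hu rfl
  have := desc_root_iff.1 (desc_end_of_map_parent h _ hu)
  subst this
  exact (List.disjoint_of_nodup_append hn) hu (by simp)

theorem one_lt_deg_of_mem_path {T : DirTree V} {v m : V} {ms : List V}
    (h : (v :: ms).map T.parent = ms ++ [m]) (hn : ((v :: ms) ++ [m]).Nodup)
    (hv : 1 < T.deg v) : ∀ u ∈ v :: ms, 1 < T.deg u := by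
  intro u hu
  rcases List.mem_cons.1 hu with rfl | hu'
  · exact hv
  · have hp : u ∈ (v :: ms).map T.parent := by rw [h]; simp [hu']
    obtain ⟨c, hc, rfl⟩ := List.mem_map.1 hp
    have h1 : c ∈ T.children (T.parent c) :=
      mem_children_iff.2 ⟨ne_root_of_mem_path h hn c hc, rfl⟩
    have h2 := Finset.card_pos.2 ⟨c, h1⟩
    have h3 := ne_root_of_mem_path h hn _ hu
    rw [deg, if_neg h3]
    omega

theorem sum_children_count {T : DirTree V} {v m : V} {ms : List V}
    (h : (v :: ms).map T.parent = ms ++ [m]) (hn : ((v :: ms) ++ [m]).Nodup) (u : V) :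
    ∑ c ∈ T.children u, ((v :: ms).count c : ℝ)
      = (v :: ms).count u - (if u = v then 1 else 0) + (if u = m then 1 else 0) := by
  have hnr := ne_root_of_mem_path h hn
  have hL : (v :: ms).Nodup := (List.nodup_append.1 hn).1
  have h1 : ∑ c ∈ T.children u, (v :: ms).count c = ((v :: ms).map T.parent).count u := by
    rw [List.count, List.countP_map, List.countP_eq_length_filter,
      ← List.toFinset_card_of_nodup (hL.filter _)]
    simp only [hL.count]
    rw [← Finset.sum_filter, Finset.sum_const, smul_eq_mul, mul_one]
    congr 1
    ext c
    simp only [Finset.mem_filter, mem_children_iff, List.mem_toFinset, List.mem_filter,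
      Function.comp_apply, beq_iff_eq]
    constructor
    · rintro ⟨⟨_, h⟩, hc⟩
      exact ⟨hc, h⟩
    · rintro ⟨hc, h⟩
      exact ⟨⟨hnr c hc, h⟩, hc⟩
  rw [← Nat.cast_sum, h1, h, List.count_append, List.count_cons (a := u) (b := v),
    List.count_cons (a := u) (b := m), List.count_nil]
  have hv' : (v == u) = true ↔ u = v := by rw [beq_iff_eq, eq_comm]
  have hm' : (m == u) = true ↔ u = m := by rw [beq_iff_eq, eq_comm]
  simp only [hv', hm']
  push_cast
  ring

end DirTree

theorem ascSum_le_of_sum_posPart_le {x y : Multiset ℝ} (hcard : Multiset.card x = Multiset.card y)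
    (h : ∀ t : ℝ, (y.map fun a => max (t - a) 0).sum ≤ (x.map fun a => max (t - a) 0).sum)
    (k : ℕ) : ascSum x k ≤ ascSum y k := by
  wlog hk : k ≤ Multiset.card x generalizing k
  · have hx : ascSum x k = ascSum x (Multiset.card x) := by
      unfold ascSum
      rw [List.take_of_length_le (by simp; omega), List.take_of_length_le (by simp)]
    have hy : ascSum y k = ascSum y (Multiset.card x) := by
      unfold ascSum
      rw [List.take_of_length_le (by simp; omega), List.take_of_length_le (by simp [hcard])]
    rw [hx, hy]
    exact this _ le_rfl
  have lower : ∀ (l : List ℝ) (t : ℝ),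
      l.length * t ≤ l.sum + (l.map fun a => max (t - a) 0).sum := by
    intro l t
    induction l with
    | nil => simp
    | cons a l ih =>
      simp only [List.length_cons, List.sum_cons, List.map_cons]
      push_cast
      linarith [le_max_left (t - a) 0]
  have split : ∀ (s : Multiset ℝ) (t : ℝ), (s.map fun a => max (t - a) 0).sum
      = (((s.sort (· ≤ ·)).take k).map fun a => max (t - a) 0).sum
        + (((s.sort (· ≤ ·)).drop k).map fun a => max (t - a) 0).sum := by
    intro s t
    rw [← List.sum_append, ← List.map_append, List.take_append_drop]
    conv_lhs => rw [← Multiset.sort_eq s (· ≤ ·)]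
    rw [Multiset.map_coe, Multiset.sum_coe]
  rcases Nat.eq_zero_or_pos k with rfl | hk0
  · simp [ascSum]
  set lx := x.sort (· ≤ ·) with hlx
  have hlen : lx.length = Multiset.card x := by simp [hlx]
  have hsorted : lx.Pairwise (· ≤ ·) := Multiset.pairwise_sort x (· ≤ ·)
  set t := lx[k - 1]'(by omega) with ht
  have hmono : ∀ i j (hi : i < lx.length) (hj : j < lx.length), i ≤ j → lx[i] ≤ lx[j] := by
    intro i j hi hj hij
    rcases hij.eq_or_lt with rfl | hij
    · exact le_rfl
    · exact List.pairwise_iff_getElem.1 hsorted i j hi hj hij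
  have htake : ∀ a ∈ lx.take k, a ≤ t := by
    intro a ha
    obtain ⟨i, hi, rfl⟩ := List.mem_iff_getElem.1 ha
    rw [List.getElem_take]
    rw [List.length_take] at hi
    exact hmono _ _ _ _ (by omega)
  have hdrop : ∀ a ∈ lx.drop k, t ≤ a := by
    intro a ha
    obtain ⟨i, hi, rfl⟩ := List.mem_iff_getElem.1 ha
    rw [List.getElem_drop]
    exact hmono _ _ _ _ (by omega)
  have exact_take : ∀ l : List ℝ, (∀ a ∈ l, a ≤ t) →
      l.sum + (l.map fun a => max (t - a) 0).sum = l.length * t := by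
    intro l hl
    induction l with
    | nil => simp
    | cons a l ih =>
      have h1 := ih fun b hb => hl b (List.mem_cons_of_mem _ hb)
      have h2 : max (t - a) 0 = t - a := max_eq_left (by linarith [hl a List.mem_cons_self])
      simp only [List.length_cons, List.sum_cons, List.map_cons, h2]
      push_cast
      linarith
  have h1 := exact_take _ htake
  have h2 : ((lx.drop k).map fun a => max (t - a) 0).sum = 0 := by
    apply List.sum_eq_zero
    intro b hb
    obtain ⟨a, ha, rfl⟩ := List.mem_map.1 hb
    exact max_eq_right (by linarith [hdrop a ha])
  have h3 := lower ((y.sort (· ≤ ·)).take k) t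
  have h4 : 0 ≤ (((y.sort (· ≤ ·)).drop k).map fun a => max (t - a) 0).sum := by
    apply List.sum_nonneg
    intro b hb
    obtain ⟨a, ha, rfl⟩ := List.mem_map.1 hb
    exact le_max_right _ _
  have h5 := h t
  rw [split y, split x, h2] at h5
  have hlk : (lx.take k).length = k := by rw [List.length_take]; omega
  have hlk' : ((y.sort (· ≤ ·)).take k).length = k := by
    rw [List.length_take, Multiset.length_sort]; omega
  rw [hlk] at h1
  rw [hlk'] at h3
  unfold ascSum
  linarith

theorem sum_map_transfer_nonneg {α : Type*} {ψ : ℝ → ℝ} {δ : ℝ} (h1 : ∀ x, ψ x ≤ ψ (x - δ))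
    (h2 : ∀ x y, x ≤ y → ψ x + ψ y ≤ ψ (x - δ) + ψ (y + δ)) (g : α → ℝ) (A B : List α)
    (hl : A.length ≤ B.length)
    (hg : ∀ i (hi : i < A.length), g (B[i]'(hi.trans_le hl)) ≤ g A[i]) :
    0 ≤ (A.map fun u => ψ (g u + δ) - ψ (g u)).sum + (B.map fun u => ψ (g u - δ) - ψ (g u)).sum := by
  induction A generalizing B with
  | nil =>
    simp only [List.map_nil, List.sum_nil, zero_add]
    apply List.sum_nonneg
    intro b hb
    obtain ⟨a, _, rfl⟩ := List.mem_map.1 hb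
    linarith [h1 (g a)]
  | cons a A ih =>
    cases B with
    | nil => simp at hl
    | cons b B =>
      have h := ih B (by simpa using hl) fun i hi => by
        have := hg (i + 1) (by simpa using hi)
        simpa using this
      have h' := h2 (g b) (g a) (hg 0 (Nat.succ_pos _))
      simp only [List.map_cons, List.sum_cons]
      linarith

/-- under degree-monotone weights, if disjoint paths lead from internal
vertices `v`, `v'` to `m`, with `k ≤ l`, `d_T(v) < d_T(v')`, `f_T(v) ≥ f_T(v')`, and
`f_T(m_i) ≥ f_T(m_i')` for `i = 1, …, k`, then some tree of `ℛ(μ,d)` has a vector of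
subordinate groups' weights strictly weakly majorizing that of `T`. -/
theorem exchange_lemma_four {V : Type} [Fintype V] [DecidableEq V]
    (μ : V → ℝ) (d : V → ℕ) (hgen : IsGenTuple μ d) (hmono : DegMonotone μ d)
    (T : DirTree V) (hT : memR T d)
    (v v' m : V) (ms ms' : List V)
    (hm : 1 < d m) (hv : 1 < d v) (hv' : 1 < d v')
    (hpath : ((v :: ms) ++ [m]).Chain' fun a b => T.parent a = b)
    (hnodup : ((v :: ms) ++ [m]).Nodup)
    (hpath' : ((v' :: ms') ++ [m]).Chain' fun a b => T.parent a = b)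
    (hnodup' : ((v' :: ms') ++ [m]).Nodup)
    (hdisj : (v :: ms).Disjoint (v' :: ms'))
    (hkl : ms.length ≤ ms'.length)
    (hdeg : T.deg v < T.deg v')
    (hf : T.f μ v' ≤ T.f μ v)
    (hmaj : ∀ i : ℕ, ∀ hi : i < ms.length,
      T.f μ (ms'.get ⟨i, lt_of_lt_of_le hi hkl⟩) ≤ T.f μ (ms.get ⟨i, hi⟩)) :
    ∃ T' : DirTree V, memR T' d ∧ SWMaj (T'.fvec μ) (T.fvec μ) := by
  have hdegT : ∀ u, T.deg u = d u := hT.2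
  have hP : (v :: ms).map T.parent = ms ++ [m] := T.map_parent_of_isChain hpath
  have hP' : (v' :: ms').map T.parent = ms' ++ [m] := T.map_parent_of_isChain hpath'
  have hnr := DirTree.ne_root_of_mem_path hP hnodup
  have hnr' := DirTree.ne_root_of_mem_path hP' hnodup'
  have hvr := hnr v List.mem_cons_self
  have hvr' := hnr' v' List.mem_cons_self
  have hvv' : v ≠ v' := fun h => hdisj List.mem_cons_self (h ▸ List.mem_cons_self)
  have hv'm : v' ∉ ms' ++ [m] := (List.nodup_cons.1 hnodup').1
  have hvm : v ∉ ms ++ [m] := (List.nodup_cons.1 hnodup).1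
  have hv'L : v' ∉ ms ++ [m] := by
    intro h
    rcases List.mem_append.1 h with h | h
    · exact hdisj (List.mem_cons_of_mem _ h) List.mem_cons_self
    · exact hv'm (List.mem_append_right _ h)
  have hvL' : v ∉ ms' ++ [m] := by
    intro h
    rcases List.mem_append.1 h with h | h
    · exact hdisj List.mem_cons_self (List.mem_cons_of_mem _ h)
    · exact hvm (List.mem_append_right _ h)
  have hcard : ∀ u, u ≠ T.root → T.deg u = (T.children u).card + 1 := by
    intro u hu
    rw [DirTree.deg, if_neg hu]
  obtain ⟨D, hD, hDcard⟩ := Finset.exists_subset_card_eq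
    (s := T.children v') (n := T.deg v' - T.deg v) (by
      have := hcard v hvr
      have := hcard v' hvr'
      omega)
  have hDpar : ∀ c ∈ D, T.parent c = v' := fun c hc => (DirTree.mem_children_iff.1 (hD hc)).2
  have hDr : ∀ c ∈ D, c ≠ T.root := fun c hc => (DirTree.mem_children_iff.1 (hD hc)).1
  have hDL : ∀ c ∈ D, c ∉ v :: ms := fun c hc h =>
    hv'L (hP ▸ List.mem_map.2 ⟨c, h, hDpar c hc⟩)
  have hDL' : ∀ c ∈ D, c ∉ v' :: ms' := fun c hc h =>
    hv'm (hP' ▸ List.mem_map.2 ⟨c, h, hDpar c hc⟩)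
  have hDv : ∀ c ∈ D, ¬ T.Desc v c := by
    intro c hc h
    rcases DirTree.desc_cases_of_map_parent hP List.mem_cons_self h with h | h
    · exact hDL c hc h
    · have h1 : T.Desc m v' := h.trans (hDpar c hc ▸ T.desc_parent c)
      have h2 := DirTree.desc_end_of_map_parent hP' v' List.mem_cons_self
      exact hv'm (by simp [h2.antisymm h1])
  have hrD : T.root ∉ D := fun h => hDr _ h rfl
  set T₁ := T.reattach D v hrD hDv with hT₁
  have hmem₁ : ∀ c u, c ∈ T₁.children u ↔
      c ≠ T.root ∧ (if c ∈ D then v else T.parent c) = u := fun c u =>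
    DirTree.mem_children_iff
  have hch₁ : ∀ u, T₁.children u =
      if u = v then T.children v ∪ D else if u = v' then T.children v' \ D else T.children u := by
    intro u
    ext c
    rw [hmem₁]
    by_cases hc : c ∈ D
    · have hcp := hDpar c hc
      have hcr := hDr c hc
      simp only [hc, if_true]
      split_ifs with h1 h2
      · simp [hc, hcr, h1]
      · simp [hc, Ne.symm h1]
      · rw [DirTree.mem_children_iff]
        simp [hcp, Ne.symm h1, Ne.symm h2]
    · simp only [hc, if_false]
      rw [← DirTree.mem_children_iff]
      split_ifs with h1 h2
      · simp [hc, h1]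
      · simp [hc, h2]
      · rfl
  have hdisjD : Disjoint (T.children v) D := by
    rw [Finset.disjoint_left]
    intro c hc hcD
    exact hvv' ((DirTree.mem_children_iff.1 hc).2.symm.trans (hDpar c hcD))
  set σ : Equiv.Perm V := Equiv.swap v v' with hσ
  have hdeg₁ : ∀ u, T₁.deg u = d (σ u) := by
    intro u
    have hr : T₁.root = T.root := rfl
    have c1 := hcard v hvr
    have c2 := hcard v' hvr'
    rw [DirTree.deg, hch₁, hr]
    by_cases h1 : u = v
    · subst h1
      rw [if_pos rfl, if_neg hvr, Finset.card_union_of_disjoint hdisjD, hDcard, hσ,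
        Equiv.swap_apply_left, ← hdegT]
      omega
    · by_cases h2 : u = v'
      · subst h2
        rw [if_neg h1, if_pos rfl, if_neg hvr', Finset.card_sdiff_of_subset hD, hDcard, hσ,
          Equiv.swap_apply_right, ← hdegT]
        omega
      · rw [if_neg h1, if_neg h2, hσ, Equiv.swap_apply_of_ne_of_ne h1 h2, ← hdegT]
        rfl
  set fD := ∑ c ∈ D, T.f μ c with hfD
  set δ := μ v' - μ v + fD with hδ
  have hδpos : 0 < δ := by
    have h1 : μ v ≤ μ v' := hmono.1 v v' hv hv' (by rw [← hdegT, ← hdegT]; exact hdeg)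
    have h2 : 0 < fD := by
      apply Finset.sum_pos
      · intro c hc
        refine T.f_pos hgen.nonneg (fun w hw => hmono.2 w ?_) (hDr c hc)
        have h3 := hdegT w
        have h4 := hgen.deg_pos w
        rw [DirTree.deg, hw, Finset.card_empty] at h3
        split_ifs at h3 <;> omega
      · rw [← Finset.card_pos, hDcard]
        omega
    linarith
  set g : V → ℝ := fun u => T.f μ u
    + δ * (((v :: ms).count u : ℝ) - ((v' :: ms').count u : ℝ)) with hg
  have hf₁ : ∀ u, T₁.f (μ ∘ σ) u = g u := by
    apply DirTree.f_eq_of_recursion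
    intro u
    have hgD : ∑ c ∈ D, g c = fD := by
      refine Finset.sum_congr rfl fun c hc => ?_
      simp only [hg, List.count_eq_zero_of_not_mem (hDL c hc),
        List.count_eq_zero_of_not_mem (hDL' c hc)]
      simp
    have hsum : ∑ c ∈ T₁.children u, g c = ∑ c ∈ T.children u, g c
        + (if u = v then fD else 0) - (if u = v' then fD else 0) := by
      rw [hch₁]
      by_cases h1 : u = v
      · subst h1
        rw [if_pos rfl, if_pos rfl, if_neg hvv', Finset.sum_union hdisjD, hgD, sub_zero]
      · by_cases h2 : u = v'
        · subst h2
          rw [if_neg h1, if_pos rfl, if_neg h1, if_pos rfl, ← Finset.sum_sdiff hD, hgD]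
          ring
        · simp [h1, h2]
    have hsum' : ∑ c ∈ T.children u, g c = ∑ c ∈ T.children u, T.f μ c
        + δ * (((v :: ms).count u : ℝ) - ((v' :: ms').count u : ℝ)
          - (if u = v then 1 else 0) + (if u = v' then 1 else 0)) := by
      simp only [hg]
      rw [Finset.sum_add_distrib, ← Finset.mul_sum, Finset.sum_sub_distrib,
        DirTree.sum_children_count hP hnodup, DirTree.sum_children_count hP' hnodup']
      ring
    have hrec := T.f_recursion μ u
    rw [hsum, hsum']
    simp only [hg, Function.comp_apply]
    by_cases h1 : u = v
    · subst h1
      simp only [hσ, Equiv.swap_apply_left, if_true, if_neg hvv']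
      linarith
    · by_cases h2 : u = v'
      · subst h2
        simp only [hσ, Equiv.swap_apply_right, if_true, if_neg h1]
        linarith
      · rw [hσ, Equiv.swap_apply_of_ne_of_ne h1 h2]
        simp only [if_neg h1, if_neg h2]
        linarith
  have hroot' : (T₁.rename σ).root = T.root :=
    Equiv.swap_apply_of_ne_of_ne hvr.symm hvr'.symm
  have hdeg' : ∀ u, (T₁.rename σ).deg u = d u := by
    intro u
    obtain ⟨u, rfl⟩ := σ.surjective u
    rw [DirTree.deg_rename, hdeg₁]
  have hf' : ∀ u, (T₁.rename σ).f μ (σ u) = g u := fun u => by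
    rw [DirTree.f_rename, hf₁]
  set S : Finset V := Finset.univ.filter fun u => 1 < d u ∧ u ≠ T.root with hS
  have hfvec : T.fvec μ = S.val.map (T.f μ) := by
    simp only [DirTree.fvec, hdegT, hS]
  have hfvec' : (T₁.rename σ).fvec μ = S.val.map ((T₁.rename σ).f μ) := by
    simp only [DirTree.fvec, hdeg', hroot', hS]
  have hLS : ∀ u ∈ v :: ms, u ∈ S := by
    intro u hu
    have := DirTree.one_lt_deg_of_mem_path hP hnodup (by rwa [hdegT]) u hu
    rw [hdegT] at this
    simp [hS, this, hnr u hu]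
  have hLS' : ∀ u ∈ v' :: ms', u ∈ S := by
    intro u hu
    have := DirTree.one_lt_deg_of_mem_path hP' hnodup' (by rwa [hdegT]) u hu
    rw [hdegT] at this
    simp [hS, this, hnr' u hu]
  have hσS : ∀ u, u ∈ S → σ u ∈ S := by
    intro u hu
    by_cases h1 : u = v
    · rw [h1, hσ, Equiv.swap_apply_left]
      exact hLS' _ List.mem_cons_self
    · by_cases h2 : u = v'
      · rw [h2, hσ, Equiv.swap_apply_right]
        exact hLS _ List.mem_cons_self
      · rwa [hσ, Equiv.swap_apply_of_ne_of_ne h1 h2]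
  have hLn : (v :: ms).Nodup := (List.nodup_append.1 hnodup).1
  have hLn' : (v' :: ms').Nodup := (List.nodup_append.1 hnodup').1
  have hsumψ : ∀ ψ : ℝ → ℝ, (((T₁.rename σ).fvec μ).map ψ).sum - ((T.fvec μ).map ψ).sum
      = ((v :: ms).map fun u => ψ (T.f μ u + δ) - ψ (T.f μ u)).sum
        + ((v' :: ms').map fun u => ψ (T.f μ u - δ) - ψ (T.f μ u)).sum := by
    intro ψ
    rw [hfvec, hfvec', Multiset.map_map, Multiset.map_map]
    change ∑ u ∈ S, ψ ((T₁.rename σ).f μ u) - ∑ u ∈ S, ψ (T.f μ u) = _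
    have e1 : ∑ u ∈ S, ψ ((T₁.rename σ).f μ u) = ∑ u ∈ S, ψ (g u) := by
      symm
      refine Finset.sum_bij' (fun u _ => σ u) (fun u _ => σ u) hσS hσS ?_ ?_ ?_
      · intro u _
        simp [hσ]
      · intro u _
        simp [hσ]
      · intro u _
        rw [hf']
    rw [e1, ← Finset.sum_sub_distrib]
    have e2 : ∑ u ∈ S, (ψ (g u) - ψ (T.f μ u))
        = ∑ u ∈ ((v :: ms) ++ (v' :: ms')).toFinset, (ψ (g u) - ψ (T.f μ u)) := by
      symm
      apply Finset.sum_subset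
      · intro u hu
        rcases List.mem_append.1 (List.mem_toFinset.1 hu) with h | h
        · exact hLS u h
        · exact hLS' u h
      · intro u _ hu
        rw [List.mem_toFinset, List.mem_append, not_or] at hu
        simp only [hg, List.count_eq_zero_of_not_mem hu.1, List.count_eq_zero_of_not_mem hu.2]
        simp
    rw [e2, List.sum_toFinset _ (hLn.append hLn' hdisj), List.map_append, List.sum_append]
    congr 2
    · refine List.map_congr_left fun u hu => ?_
      simp only [hg, List.count_eq_one_of_mem hLn hu, List.count_eq_zero_of_not_mem (hdisj hu)]
      simp
    · refine List.map_congr_left fun u hu => ?_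
      simp only [hg, List.count_eq_one_of_mem hLn' hu,
        List.count_eq_zero_of_not_mem (hdisj.symm hu)]
      simp [sub_eq_add_neg]
  refine ⟨T₁.rename σ, ⟨by rw [hroot']; exact hT.1, hdeg'⟩, ⟨?_, ?_⟩, ?_⟩
  · rw [hfvec, hfvec', Multiset.card_map, Multiset.card_map]
  · apply ascSum_le_of_sum_posPart_le
    · rw [hfvec, hfvec', Multiset.card_map, Multiset.card_map]
    · intro t
      rw [← sub_nonneg, hsumψ]
      refine sum_map_transfer_nonneg (ψ := fun x => max (t - x) 0) (δ := δ) (fun x => ?_)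
        (fun x y hxy => ?_) (T.f μ) _ _
        (by simpa using hkl) ?_
      · exact max_le_max_right _ (by linarith)
      · rcases max_cases (t - x) 0 with h1 | h1 <;> rcases max_cases (t - y) 0 with h2 | h2 <;>
        rcases max_cases (t - (x - δ)) 0 with h3 | h3 <;>
        rcases max_cases (t - (y + δ)) 0 with h4 | h4 <;> linarith
      · intro i hi
        cases i with
        | zero => exact hf
        | succ i => exact hmaj i (by simpa using hi)
  · intro heq
    have h := hsumψ fun x => Real.exp (-x)
    rw [heq, sub_self, List.map_cons, List.map_cons, List.sum_cons, List.sum_cons] at h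
    have pair : ∀ x y : ℝ, x ≤ y → Real.exp (-x) + Real.exp (-y)
        < Real.exp (-(x - δ)) + Real.exp (-(y + δ)) := by
      intro x y hxy
      have e1 : Real.exp (-(x - δ)) = Real.exp (-x) * Real.exp δ := by
        rw [← Real.exp_add]; ring_nf
      have e2 : Real.exp (-y) = Real.exp (-(y + δ)) * Real.exp δ := by
        rw [← Real.exp_add]; ring_nf
      have e3 : 1 < Real.exp δ := Real.one_lt_exp_iff.2 hδpos
      have e4 : Real.exp (-(y + δ)) < Real.exp (-x) := Real.exp_lt_exp.2 (by linarith)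
      rw [e1, e2]
      nlinarith
    have h1 := sum_map_transfer_nonneg (ψ := fun x => Real.exp (-x)) (δ := δ)
      (fun x => Real.exp_le_exp.2 (by linarith)) (fun x y hxy => (pair x y hxy).le)
      (T.f μ) ms ms' hkl hmaj
    have h2 := pair _ _ hf
    linarith
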